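/- arXiv:1312.6518 — 4 statements merged into one kernel-verified Lean document; each statement's English description precedes it below -/
import Mathlib

section
/- Let 𝔤 be a finite-dimensional real Lie algebra with a nondegenerate symmetric bilinear form g, let ∇ be its Levi-Civita product and R its curvature tensor. Let ξ ∈ 𝔤 satisfy g(ξ,ξ) = 1, set η(X) = g(X,ξ), and let φ : 𝔤 → 𝔤 be linear with φξ = 0, φ(φX) = X − η(X)ξ, and g(φX,φY) = −g(X,Y) + η(X)η(Y) for all X,Y. Assume that ∇_X ξ = −φX for all X ∈ 𝔤 (the condition satisfied when ξ is a Killing vector field of the associated left-invariant paracontact metric structure), and that R(X,Y)ξ = −(η(Y)X − η(X)Y) for all X,Y ∈ 𝔤. Then ∇_X(φY) − φ(∇_X Y) = −g(X,Y)ξ + η(Y)X for all X,Y ∈ 𝔤, i.e. the structure satisfies the paraSasakian condition (∇_X φ)Y = −g(X,Y)ξ + η(Y)X. -/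
/-- Left-invariant version of Theorem 3.1 of the paper: if `∇_x ξ = -φ x`
(the condition when `ξ` is Killing) and `R(x,y)ξ = -(η(y)x - η(x)y)`, then the
paraSasakian condition `(∇_x φ) y = -g(x,y) ξ + η(y) x` holds. -/
theorem paraSasakian_of_killing_and_curvature
    (𝔤 : Type*) [LieRing 𝔤] [LieAlgebra ℝ 𝔤] [Module.Finite ℝ 𝔤]
    (g : 𝔤 →ₗ[ℝ] 𝔤 →ₗ[ℝ] ℝ)
    (hgsymm : ∀ x y : 𝔤, g x y = g y x)
    (hgnd : ∀ x : 𝔤, (∀ y : 𝔤, g x y = 0) → x = 0)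
    (ξ : 𝔤) (hξ : g ξ ξ = 1)
    (η : 𝔤 → ℝ) (hη : ∀ x, η x = g x ξ)
    (φ : 𝔤 →ₗ[ℝ] 𝔤)
    (hφξ : φ ξ = 0)
    (hφ2 : ∀ x, φ (φ x) = x - η x • ξ)
    (hgφφ : ∀ x y, g (φ x) (φ y) = -g x y + η x * η y)
    (nabla : 𝔤 →ₗ[ℝ] 𝔤 →ₗ[ℝ] 𝔤)
    (hkoszul : ∀ x y z : 𝔤,
      2 * g (nabla x y) z = g ⁅x, y⁆ z - g ⁅y, z⁆ x + g ⁅z, x⁆ y)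
    (R : 𝔤 → 𝔤 → 𝔤 → 𝔤)
    (hR : ∀ x y z : 𝔤,
      R x y z = nabla x (nabla y z) - nabla y (nabla x z) - nabla ⁅x, y⁆ z)
    (hKilling : ∀ x : 𝔤, nabla x ξ = -φ x)
    (hcurv : ∀ x y : 𝔤, R x y ξ = -(η y • x - η x • y)) :
    ∀ x y : 𝔤, nabla x (φ y) - φ (nabla x y) = -(g x y) • ξ + η y • x := by
  have brk : ∀ x y z : 𝔤, g ⁅x, y⁆ z = - g ⁅y, x⁆ z := by
    intro x y z
    rw [← lie_skew x y, map_neg, LinearMap.neg_apply]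
  have hmet : ∀ x y z : 𝔤, g (nabla x y) z = - g (nabla x z) y := by
    intro x y z
    have h1 := hkoszul x y z
    have h2 := hkoszul x z y
    have h3 := brk x y z
    have h4 := brk y z x
    have h5 := brk z x y
    linarith
  have htor : ∀ x y : 𝔤, ⁅x, y⁆ = nabla x y - nabla y x := by
    intro x y
    rw [← sub_eq_zero]
    apply hgnd
    intro z
    have h1 := hkoszul x y z
    have h2 := hkoszul y x z
    have h3 := brk x y z
    have h4 := brk y z x
    have h5 := brk z x y
    simp only [map_sub, LinearMap.sub_apply]
    linarith
  have hηφ : ∀ y, η (φ y) = 0 := by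
    intro y
    have h1 := hφ2 (φ y)
    rw [hφ2 y, map_sub, map_smul, hφξ, smul_zero, sub_zero] at h1
    have h2 : η (φ y) • ξ = 0 := by
      have := sub_eq_self.mp h1.symm
      exact this
    have h3 := congrArg (fun v => g v ξ) h2
    simpa [hξ] using h3
  have hskew : ∀ x y, g (φ x) y = - g x (φ y) := by
    intro x y
    have h1 := hgφφ x (φ y)
    have h2 := hηφ x
    rw [hη] at h2
    rw [hφ2 y, hηφ y, map_sub, map_smul, h2] at h1
    simpa using h1
  have hC : ∀ x y : 𝔤, (nabla x (φ y) - φ (nabla x y)) - (nabla y (φ x) - φ (nabla y x))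
      = η y • x - η x • y := by
    intro x y
    have h1 := hcurv x y
    rw [hR, hKilling, hKilling, hKilling, htor x y, map_sub, map_neg, map_neg] at h1
    rw [← neg_inj, ← h1]
    abel
  have hTs : ∀ x y z : 𝔤, g (nabla x (φ y) - φ (nabla x y)) z
      = - g (nabla x (φ z) - φ (nabla x z)) y := by
    intro x y z
    simp only [map_sub, LinearMap.sub_apply]
    have h1 := hmet x (φ y) z
    have h2 := hmet x (φ z) y
    have h3 := hskew (nabla x y) z
    have h4 := hskew (nabla x z) y
    linarith
  have hTc : ∀ x y z : 𝔤, g (nabla x (φ y) - φ (nabla x y)) z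
      - g (nabla y (φ x) - φ (nabla y x)) z = η y * g x z - η x * g y z := by
    intro x y z
    have := congrArg (fun v => g v z) (hC x y)
    simpa only [map_sub, LinearMap.sub_apply, map_smul, LinearMap.smul_apply, smul_eq_mul] using this
  intro x y
  rw [← sub_eq_zero]
  apply hgnd
  intro z
  have key : g (nabla x (φ y) - φ (nabla x y)) z = -(g x y) * g ξ z + η y * g x z := by
    have a1 := hTs x y z
    have a2 := hTs y z x
    have a3 := hTs z x y
    have b1 := hTc x y z
    have b2 := hTc y z x
    have b3 := hTc z x y
    rw [hgsymm ξ z, ← hη]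
    rw [hgsymm y x] at *
    rw [hgsymm z x] at *
    rw [hgsymm z y] at *
    linarith
  rw [map_sub, LinearMap.sub_apply, key]
  simp only [map_add, LinearMap.add_apply, map_smul, LinearMap.smul_apply, smul_eq_mul]
  ring
end

section
/- Let n ≥ 1 and 1 ≤ m ≤ n. The alternating bilinear bracket on the (2n+1)-dimensional real vector space with basis {ξ, X₁, Y₁, …, Xₙ, Yₙ} whose only non-vanishing values on basis vectors are: [ξ, Xᵢ] = Yᵢ for i = 1,…,m; [Xᵢ, Yⱼ] = δᵢⱼ(2ξ + √2(1+δᵢₘ)Yₘ) + (1−δᵢⱼ)√2(δᵢₘYⱼ + δⱼₘYᵢ) for i,j = 1,…,m; [Xᵢ, Yⱼ] = δᵢⱼ(2ξ + √2Yᵢ) for i,j = m+1,…,n; and [Xᵢ, Yⱼ] = √2 Yᵢ for i = 1,…,m and j = m+1,…,n; satisfies the Jacobi identity, i.e. it defines a Lie algebra structure. -/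
/-- The alternating bilinear bracket of Example 4.2 of the paper (on the
`(2n+1)`-dimensional space with basis `ξ, X₁, Y₁, …, Xₙ, Yₙ`, here realized as
the standard basis vectors `Pi.single` of `(Unit ⊕ Fin n ⊕ Fin n) → ℝ`, with
`eX i` 0-indexed so that `i.val < m` means `i ∈ {1,…,m}` and `m'` is the index
of `Xₘ, Yₘ`) satisfies the Jacobi identity. -/
theorem jacobi_identity_example_mu2_rank_m
    (n m : ℕ) (hm1 : 1 ≤ m) (hmn : m ≤ n)
    (m' : Fin n) (hm' : (m' : ℕ) = m - 1)
    (br : ((Unit ⊕ Fin n ⊕ Fin n) → ℝ) →ₗ[ℝ] ((Unit ⊕ Fin n ⊕ Fin n) → ℝ) →ₗ[ℝ]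
      ((Unit ⊕ Fin n ⊕ Fin n) → ℝ))
    (eξ : (Unit ⊕ Fin n ⊕ Fin n) → ℝ) (heξ : eξ = Pi.single (Sum.inl ()) 1)
    (eX : Fin n → (Unit ⊕ Fin n ⊕ Fin n) → ℝ)
    (heX : ∀ i, eX i = Pi.single (Sum.inr (Sum.inl i)) 1)
    (eY : Fin n → (Unit ⊕ Fin n ⊕ Fin n) → ℝ)
    (heY : ∀ i, eY i = Pi.single (Sum.inr (Sum.inr i)) 1)
    -- the bracket is alternating:
    (halt : ∀ v, br v v = 0)
    -- the only non-vanishing values on basis vectors: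
    (hξX : ∀ i : Fin n, br eξ (eX i) = if (i : ℕ) < m then eY i else 0)
    (hξY : ∀ i : Fin n, br eξ (eY i) = 0)
    (hXX : ∀ i j : Fin n, br (eX i) (eX j) = 0)
    (hYY : ∀ i j : Fin n, br (eY i) (eY j) = 0)
    (hXY : ∀ i j : Fin n, br (eX i) (eY j) =
      if (i : ℕ) < m then
        (if (j : ℕ) < m then
          (if i = j then
            (2 : ℝ) • eξ + (Real.sqrt 2 * (1 + (if i = m' then (1 : ℝ) else 0))) • eY m'
          else
            (Real.sqrt 2 * (if i = m' then (1 : ℝ) else 0)) • eY j +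
              (Real.sqrt 2 * (if j = m' then (1 : ℝ) else 0)) • eY i)
        else Real.sqrt 2 • eY i)
      else
        (if (j : ℕ) < m then 0
         else if i = j then (2 : ℝ) • eξ + Real.sqrt 2 • eY i else 0)) :
    ∀ u v w, br u (br v w) + br v (br w u) + br w (br u v) = 0 := by
  have anti : ∀ a b, br a b = - br b a := by
    intro a b
    have h := halt (a + b)
    simp only [map_add, LinearMap.add_apply, halt, zero_add, add_zero] at h
    exact eq_neg_of_add_eq_zero_right h
  have hm : (m' : ℕ) < m := by omega
  have h2 : Real.sqrt 2 * Real.sqrt 2 = 2 := Real.mul_self_sqrt (by norm_num)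
  have hXξ : ∀ i : Fin n, br (eX i) eξ = if (i : ℕ) < m then - eY i else 0 := by
    intro i
    rw [anti, hξX]
    split_ifs <;> simp
  have hYξ : ∀ i : Fin n, br (eY i) eξ = 0 := by
    intro i
    rw [anti, hξY, neg_zero]
  have hYX : ∀ i j : Fin n, br (eY j) (eX i) = - br (eX i) (eY j) := fun i j => anti _ _
  have hξbr : ∀ i j, br eξ (br (eX i) (eY j)) = 0 := by
    intro i j
    rw [hXY]
    split_ifs <;> simp [halt, hξY]
  have hYbr : ∀ i j k, br (eY k) (br (eX i) (eY j)) = 0 := by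
    intro i j k
    rw [hXY]
    split_ifs <;> simp [hYY, hYξ]
  have hsymm : ∀ i j : Fin n, (i : ℕ) < m → (j : ℕ) < m →
      br (eX i) (eY j) = br (eX j) (eY i) := by
    intro i j hi hj
    by_cases hij : i = j
    · rw [hij]
    · rw [hXY, hXY]
      simp only [hi, hj, hij, Ne.symm hij, if_true, if_false]
      rw [add_comm]
  have hA : ∀ i j k : Fin n,
      br (eX i) (br (eX j) (eY k)) = br (eX j) (br (eX i) (eY k)) := by
    intro i j k
    by_cases hij : i = j
    · rw [hij]
    have key : ∀ i j : Fin n, (i : ℕ) < m → ¬ (j : ℕ) < m →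
        br (eX i) (br (eX j) (eY k)) = br (eX j) (br (eX i) (eY k)) := by
      intro i j hi hj
      have hne : j ≠ i := by rintro rfl; exact hj hi
      by_cases hk : (k : ℕ) < m
      · have hne' : j ≠ k := by rintro rfl; exact hj hk
        have hne2 : j ≠ m' := by rintro rfl; exact hj hm
        rw [hXY j k, hXY i k]
        simp only [hi, hj, hk, if_true, if_false, map_zero]
        split_ifs <;> simp [hXξ, hXY j, hj, hi, hk, hm]
      · rw [hXY j k, hXY i k]
        simp only [hi, hj, hk, if_true, if_false]
        by_cases hjk : j = k
        · simp [hjk, hXξ, hXY, hi, hj, hk, smul_smul, h2]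
        · simp [hjk, hXY j, hi, hj]
    by_cases hi : (i : ℕ) < m <;> by_cases hj : (j : ℕ) < m
    · by_cases hk : (k : ℕ) < m
      · have key2 : ∀ i j : Fin n, (i : ℕ) < m → (j : ℕ) < m → i ≠ j →
            br (eX i) (br (eX j) (eY j)) = br (eX j) (br (eX i) (eY j)) := by
          intro i j hi hj hij
          by_cases him : i = m'
          · subst him
            simp [hXY, hXξ, hi, hj, hij, Ne.symm hij, smul_smul, smul_add]
            match_scalars <;> nlinarith [h2]
          · by_cases hjm : j = m'
            · subst hjm
              simp [hXY, hXξ, hi, hj, hij, Ne.symm hij, smul_smul, smul_add]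
              match_scalars <;> nlinarith [h2]
            · simp [hXY, hXξ, hi, hj, hij, him, hjm, hm, Ne.symm hij, smul_smul, smul_add]
        by_cases hjk : j = k
        · subst hjk; exact key2 i j hi hj hij
        by_cases hik : i = k
        · subst hik; exact (key2 j i hj hi (Ne.symm hij)).symm
        rw [hXY j k, hXY i k]
        simp only [hi, hj, hk, hjk, hik, if_true, if_false, map_add, map_smul, hsymm i j hi hj]
        congr 1
        by_cases him : i = m'
        · subst him
          simp [hXY, hj, hk, hjk, Ne.symm hij, Ne.symm hik]
        · by_cases hjm : j = m'
          · subst hjm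
            simp [hXY, hi, hk, hik, him, Ne.symm hjk]
          · simp [him, hjm]
      · rw [hXY j k, hXY i k]
        simp only [hi, hj, hk, if_true, if_false, map_smul]
        rw [hsymm i j hi hj]
    · exact key i j hi hj
    · exact (key j i hj hi).symm
    · rw [hXY j k, hXY i k]
      simp only [hi, hj, if_false]
      by_cases hk : (k : ℕ) < m
      · simp [hk]
      · by_cases hjk : j = k
        · subst hjk
          simp [hk, hij, hXξ, hi, hXY]
        · by_cases hik : i = k
          · subst hik
            simp [hk, hjk, hXξ, hj, hXY]
          · simp [hk, hjk, hik]
  have hB : ∀ i j : Fin n, br (eX i) (br eξ (eX j)) = br (eX j) (br eξ (eX i)) := by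
    intro i j
    rw [hξX, hξX]
    by_cases hi : (i : ℕ) < m <;> by_cases hj : (j : ℕ) < m
    · simp only [hi, hj, if_true]; exact hsymm i j hi hj
    · simp [hi, hj, hXY]
    · simp [hi, hj, hXY]
    · simp [hi, hj]
  have hYξX : ∀ i j, br (eY i) (br eξ (eX j)) = 0 := by
    intro i j
    rw [hξX]
    split_ifs <;> simp [hYY]
  have hξξX : ∀ j, br eξ (br eξ (eX j)) = 0 := by
    intro j
    rw [hξX]
    split_ifs <;> simp [hξY]
  have hXξ' : ∀ i, br (eX i) eξ = - br eξ (eX i) := fun i => anti _ _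
  have ind : ∀ P : ((Unit ⊕ Fin n ⊕ Fin n) → ℝ) → Prop,
      (∀ a b, P a → P b → P (a + b)) → (∀ (c : ℝ) a, P a → P (c • a)) →
      P eξ → (∀ i, P (eX i)) → (∀ i, P (eY i)) → ∀ v, P v := by
    intro P hadd hsmul h1 h3 h4 v
    rw [pi_eq_sum_univ' v]
    apply Finset.sum_induction _ P hadd
    · simpa using hsmul 0 _ h1
    · intro i _
      apply hsmul
      rcases i with _ | i | i
      · convert h1 using 1
        rw [heξ]
      · convert h3 i using 1
        rw [heX]
      · convert h4 i using 1
        rw [heY]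
  have base : ∀ u v w, (u = eξ ∨ (∃ i, u = eX i) ∨ ∃ i, u = eY i) →
      (v = eξ ∨ (∃ i, v = eX i) ∨ ∃ i, v = eY i) →
      (w = eξ ∨ (∃ i, w = eX i) ∨ ∃ i, w = eY i) →
      br u (br v w) + br v (br w u) + br w (br u v) = 0 := by
    clear hXY hξX hXξ
    rintro u v w (rfl | ⟨i, rfl⟩ | ⟨i, rfl⟩) (rfl | ⟨j, rfl⟩ | ⟨j, rfl⟩)
      (rfl | ⟨k, rfl⟩ | ⟨k, rfl⟩) <;>
    simp only [halt, hξY, hXX, hYY, hYξ, hYX, hXξ', hξbr, hYbr, hYξX, hξξX, map_zero, map_neg,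
      neg_zero, add_zero, zero_add, neg_neg, neg_add_cancel, add_neg_cancel]
    · rw [hB j k]; simp
    · rw [hB i k]; simp
    · rw [hB i j]; simp
    · rw [hA i j k]; simp
    · rw [hA i k j]; simp
    · rw [hA j k i]; simp
  have lin1 : ∀ v w, (∀ u, (u = eξ ∨ (∃ i, u = eX i) ∨ ∃ i, u = eY i) →
      br u (br v w) + br v (br w u) + br w (br u v) = 0) →
      ∀ u, br u (br v w) + br v (br w u) + br w (br u v) = 0 := by
    intro v w h
    apply ind
    · intro a b ha hb
      simp only [map_add, LinearMap.add_apply]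
      rw [← add_zero (0 : (Unit ⊕ Fin n ⊕ Fin n) → ℝ)]
      nth_rewrite 1 [← ha]
      rw [← hb]
      abel
    · intro c a ha
      simp only [map_smul, LinearMap.smul_apply, ← smul_add, ha, smul_zero]
    · exact h _ (Or.inl rfl)
    · exact fun i => h _ (Or.inr (Or.inl ⟨i, rfl⟩))
    · exact fun i => h _ (Or.inr (Or.inr ⟨i, rfl⟩))
  have cyc : ∀ u v w, br u (br v w) + br v (br w u) + br w (br u v) = 0 →
      br v (br w u) + br w (br u v) + br u (br v w) = 0 := by
    intro u v w h
    rw [← h]; abel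
  intro u v w
  apply lin1
  intro u hu
  apply cyc w u v
  apply cyc v w u
  apply lin1
  intro v hv
  apply cyc u v w
  apply cyc w u v
  apply cyc v w u
  apply cyc u v w
  apply cyc w u v
  apply lin1
  intro w hw
  exact base _ _ _ hw hu hv
end

section
/- The alternating bilinear bracket on the 5-dimensional real vector space with basis {ξ, X₁, Y₁, X₂, Y₂} whose values on basis vectors are [ξ,X₁] = Y₁ + X₁ + X₂, [ξ,Y₁] = −Y₁ + Y₂, [ξ,X₂] = Y₂ + X₁ + X₂, [ξ,Y₂] = Y₁ − Y₂, [X₁,Y₁] = 2ξ + X₂ + (3/2)Y₂, [X₂,Y₂] = −2ξ + X₁ − (1/2)Y₁, [X₁,X₂] = (3/2)X₁ + (1/2)X₂, [Y₁,Y₂] = −Y₁ + Y₂, [X₁,Y₂] = (3/2)Y₁ + X₂, [Y₁,X₂] = −X₁ + (1/2)Y₂, satisfies the Jacobi identity, i.e. it defines a Lie algebra structure. -/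
set_option maxHeartbeats 2000000 in
/-- The alternating bilinear bracket of Example 4.6 of the paper (on the
5-dimensional space with basis `ξ, X₁, Y₁, X₂, Y₂`, here realized as the
standard basis vectors of `Fin 5 → ℝ`) satisfies the Jacobi identity. -/
theorem jacobi_identity_dim5_mu0_rank2
    (br : (Fin 5 → ℝ) →ₗ[ℝ] (Fin 5 → ℝ) →ₗ[ℝ] (Fin 5 → ℝ))
    (ξ X1 Y1 X2 Y2 : Fin 5 → ℝ)
    (hξ : ξ = Pi.single 0 1) (hX1 : X1 = Pi.single 1 1) (hY1 : Y1 = Pi.single 2 1)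
    (hX2 : X2 = Pi.single 3 1) (hY2 : Y2 = Pi.single 4 1)
    -- the bracket is alternating:
    (halt : ∀ v, br v v = 0)
    -- the values on basis vectors:
    (br1 : br ξ X1 = Y1 + X1 + X2)
    (br2 : br ξ Y1 = -Y1 + Y2)
    (br3 : br ξ X2 = Y2 + X1 + X2)
    (br4 : br ξ Y2 = Y1 - Y2)
    (br5 : br X1 Y1 = (2 : ℝ) • ξ + X2 + (3 / 2 : ℝ) • Y2)
    (br6 : br X2 Y2 = -((2 : ℝ) • ξ) + X1 - (1 / 2 : ℝ) • Y1)
    (br7 : br X1 X2 = (3 / 2 : ℝ) • X1 + (1 / 2 : ℝ) • X2)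
    (br8 : br Y1 Y2 = -Y1 + Y2)
    (br9 : br X1 Y2 = (3 / 2 : ℝ) • Y1 + X2)
    (br10 : br Y1 X2 = -X1 + (1 / 2 : ℝ) • Y2) :
    ∀ u v w, br u (br v w) + br v (br w u) + br w (br u v) = 0 := by
  have skew : ∀ a b, br a b = - br b a := by
    intro a b
    have h := halt (a + b)
    simp only [map_add, LinearMap.add_apply, halt, zero_add, add_zero] at h
    exact eq_neg_of_add_eq_zero_right h
  have dec : ∀ v : Fin 5 → ℝ,
      v = v 0 • ξ + v 1 • X1 + v 2 • Y1 + v 3 • X2 + v 4 • Y2 := by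
    intro v
    subst hξ hX1 hY1 hX2 hY2
    ext i
    fin_cases i <;> simp [Pi.single_apply]
  have key : ∀ u v : Fin 5 → ℝ, br u v =
      (u 0 * v 1 - u 1 * v 0) • (Y1 + X1 + X2)
      + (u 0 * v 2 - u 2 * v 0) • (-Y1 + Y2)
      + (u 0 * v 3 - u 3 * v 0) • (Y2 + X1 + X2)
      + (u 0 * v 4 - u 4 * v 0) • (Y1 - Y2)
      + (u 1 * v 2 - u 2 * v 1) • ((2 : ℝ) • ξ + X2 + (3 / 2 : ℝ) • Y2)
      + (u 3 * v 4 - u 4 * v 3) • (-((2 : ℝ) • ξ) + X1 - (1 / 2 : ℝ) • Y1)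
      + (u 1 * v 3 - u 3 * v 1) • ((3 / 2 : ℝ) • X1 + (1 / 2 : ℝ) • X2)
      + (u 2 * v 4 - u 4 * v 2) • (-Y1 + Y2)
      + (u 1 * v 4 - u 4 * v 1) • ((3 / 2 : ℝ) • Y1 + X2)
      + (u 2 * v 3 - u 3 * v 2) • (-X1 + (1 / 2 : ℝ) • Y2) := by
    intro u v
    conv_lhs => rw [dec u, dec v]
    simp only [map_add, map_smul, LinearMap.add_apply, LinearMap.smul_apply, halt,
      skew X1 ξ, skew Y1 ξ, skew X2 ξ, skew Y2 ξ, skew Y1 X1, skew X2 X1, skew Y2 X1,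
      skew X2 Y1, skew Y2 Y1, skew Y2 X2, br1, br2, br3, br4, br5, br6, br7, br8, br9, br10]
    module
  intro u v w
  have c : ∀ u v : Fin 5 → ℝ,
      br u v 0 = 2 * (u 1 * v 2 - u 2 * v 1) - 2 * (u 3 * v 4 - u 4 * v 3) ∧
      br u v 1 = (u 0 * v 1 - u 1 * v 0) + (u 0 * v 3 - u 3 * v 0) + (u 3 * v 4 - u 4 * v 3)
        + 3 / 2 * (u 1 * v 3 - u 3 * v 1) - (u 2 * v 3 - u 3 * v 2) ∧
      br u v 2 = (u 0 * v 1 - u 1 * v 0) - (u 0 * v 2 - u 2 * v 0) + (u 0 * v 4 - u 4 * v 0)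
        - 1 / 2 * (u 3 * v 4 - u 4 * v 3) - (u 2 * v 4 - u 4 * v 2)
        + 3 / 2 * (u 1 * v 4 - u 4 * v 1) ∧
      br u v 3 = (u 0 * v 1 - u 1 * v 0) + (u 0 * v 3 - u 3 * v 0) + (u 1 * v 2 - u 2 * v 1)
        + 1 / 2 * (u 1 * v 3 - u 3 * v 1) + (u 1 * v 4 - u 4 * v 1) ∧
      br u v 4 = (u 0 * v 2 - u 2 * v 0) + (u 0 * v 3 - u 3 * v 0) - (u 0 * v 4 - u 4 * v 0)
        + 3 / 2 * (u 1 * v 2 - u 2 * v 1) + (u 2 * v 4 - u 4 * v 2)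
        + 1 / 2 * (u 2 * v 3 - u 3 * v 2) := by
    intro u v
    rw [key]
    subst hξ hX1 hY1 hX2 hY2
    refine ⟨?_, ?_, ?_, ?_, ?_⟩ <;> simp [Pi.single_apply] <;> ring
  have c0 := fun u v => (c u v).1
  have c1 := fun u v => (c u v).2.1
  have c2 := fun u v => (c u v).2.2.1
  have c3 := fun u v => (c u v).2.2.2.1
  have c4 := fun u v => (c u v).2.2.2.2
  have e0 : (br u (br v w) + br v (br w u) + br w (br u v)) 0 = 0 := by
    simp only [Pi.add_apply, c0, c1, c2, c3, c4]; ring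
  have e1 : (br u (br v w) + br v (br w u) + br w (br u v)) 1 = 0 := by
    simp only [Pi.add_apply, c0, c1, c2, c3, c4]; ring
  have e2 : (br u (br v w) + br v (br w u) + br w (br u v)) 2 = 0 := by
    simp only [Pi.add_apply, c0, c1, c2, c3, c4]; ring
  have e3 : (br u (br v w) + br v (br w u) + br w (br u v)) 3 = 0 := by
    simp only [Pi.add_apply, c0, c1, c2, c3, c4]; ring
  have e4 : (br u (br v w) + br v (br w u) + br w (br u v)) 4 = 0 := by
    simp only [Pi.add_apply, c0, c1, c2, c3, c4]; ring
  ext i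
  fin_cases i
  · exact e0
  · exact e1
  · exact e2
  · exact e3
  · exact e4
end

section
/- The alternating bilinear bracket on the 7-dimensional real vector space with basis {ξ, X₁, Y₁, X₂, Y₂, X₃, Y₃} whose only non-vanishing values on basis vectors are [ξ,X₁] = Y₁ + X₁ + X₂, [ξ,Y₁] = −Y₁ + Y₂, [ξ,X₂] = Y₂ + X₁ + X₂, [ξ,Y₂] = Y₁ − Y₂, [ξ,X₃] = X₃ + Y₃, [ξ,Y₃] = −Y₃, [X₁,Y₁] = 2ξ + √2(X₂ + Y₂), [X₂,Y₂] = −2ξ + √2 X₁, [X₃,Y₃] = −2ξ + √2(X₁ − X₂ − Y₂), [X₁,X₂] = −[Y₁,X₂] = √2 X₁, [X₁,Y₂] = √2(Y₁ + X₂), [Y₁,Y₂] = √2(−Y₁ + Y₂), [X₁,Y₃] = −[X₂,X₃] = [X₂,Y₃] = √2 X₃, [Y₁,Y₃] = −[Y₂,X₃] = [Y₂,Y₃] = √2 Y₃, satisfies the Jacobi identity, i.e. it defines a Lie algebra structure. -/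
/-- The alternating bilinear bracket of Example 4.8 of the paper (on the
7-dimensional space with basis `ξ, X₁, Y₁, X₂, Y₂, X₃, Y₃`, here realized as
the standard basis vectors of `Fin 7 → ℝ`) satisfies the Jacobi identity. -/
theorem jacobi_identity_dim7_mu0_rank3
    (br : (Fin 7 → ℝ) →ₗ[ℝ] (Fin 7 → ℝ) →ₗ[ℝ] (Fin 7 → ℝ))
    (ξ X1 Y1 X2 Y2 X3 Y3 : Fin 7 → ℝ)
    (hξ : ξ = Pi.single 0 1) (hX1 : X1 = Pi.single 1 1) (hY1 : Y1 = Pi.single 2 1)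
    (hX2 : X2 = Pi.single 3 1) (hY2 : Y2 = Pi.single 4 1)
    (hX3 : X3 = Pi.single 5 1) (hY3 : Y3 = Pi.single 6 1)
    -- the bracket is alternating:
    (halt : ∀ v, br v v = 0)
    -- the values on basis vectors (the unlisted ones vanish):
    (br1 : br ξ X1 = Y1 + X1 + X2)
    (br2 : br ξ Y1 = -Y1 + Y2)
    (br3 : br ξ X2 = Y2 + X1 + X2)
    (br4 : br ξ Y2 = Y1 - Y2)
    (br5 : br ξ X3 = X3 + Y3)
    (br6 : br ξ Y3 = -Y3)
    (br7 : br X1 Y1 = (2 : ℝ) • ξ + Real.sqrt 2 • (X2 + Y2))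
    (br8 : br X2 Y2 = -((2 : ℝ) • ξ) + Real.sqrt 2 • X1)
    (br9 : br X3 Y3 = -((2 : ℝ) • ξ) + Real.sqrt 2 • (X1 - X2 - Y2))
    (br10 : br X1 X2 = Real.sqrt 2 • X1)
    (br11 : br Y1 X2 = -(Real.sqrt 2 • X1))
    (br12 : br X1 Y2 = Real.sqrt 2 • (Y1 + X2))
    (br13 : br Y1 Y2 = Real.sqrt 2 • (-Y1 + Y2))
    (br14 : br X1 Y3 = Real.sqrt 2 • X3)
    (br15 : br X2 X3 = -(Real.sqrt 2 • X3))
    (br16 : br X2 Y3 = Real.sqrt 2 • X3)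
    (br17 : br Y1 Y3 = Real.sqrt 2 • Y3)
    (br18 : br Y2 X3 = -(Real.sqrt 2 • Y3))
    (br19 : br Y2 Y3 = Real.sqrt 2 • Y3)
    (br20 : br X1 X3 = 0)
    (br21 : br Y1 X3 = 0) :
    ∀ u v w, br u (br v w) + br v (br w u) + br w (br u v) = 0 := by
  have hr : Real.sqrt 2 * Real.sqrt 2 = 2 := Real.mul_self_sqrt (by norm_num)
  generalize Real.sqrt 2 = r at *
  have sk : ∀ u v, br u v = -br v u := by
    intro u v
    have h := halt (u + v)
    simp only [map_add, LinearMap.add_apply, halt, zero_add, add_zero] at h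
    rw [add_comm] at h
    exact eq_neg_of_add_eq_zero_left (by rw [add_comm] at h; simpa [add_comm] using h)
  have sk1 := sk X1 ξ
  rw [br1] at sk1
  have sk2 := sk Y1 ξ
  rw [br2] at sk2
  have sk3 := sk X2 ξ
  rw [br3] at sk3
  have sk4 := sk Y2 ξ
  rw [br4] at sk4
  have sk5 := sk X3 ξ
  rw [br5] at sk5
  have sk6 := sk Y3 ξ
  rw [br6] at sk6
  have sk7 := sk Y1 X1
  rw [br7] at sk7
  have sk8 := sk Y2 X2
  rw [br8] at sk8
  have sk9 := sk Y3 X3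
  rw [br9] at sk9
  have sk10 := sk X2 X1
  rw [br10] at sk10
  have sk11 := sk X2 Y1
  rw [br11] at sk11
  have sk12 := sk Y2 X1
  rw [br12] at sk12
  have sk13 := sk Y2 Y1
  rw [br13] at sk13
  have sk14 := sk Y3 X1
  rw [br14] at sk14
  have sk15 := sk X3 X2
  rw [br15] at sk15
  have sk16 := sk Y3 X2
  rw [br16] at sk16
  have sk17 := sk Y3 Y1
  rw [br17] at sk17
  have sk18 := sk X3 Y2
  rw [br18] at sk18
  have sk19 := sk Y3 Y2
  rw [br19] at sk19
  have sk20 := sk X3 X1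
  rw [br20] at sk20
  have sk21 := sk X3 Y1
  rw [br21] at sk21
  let J : (Fin 7 → ℝ) → (Fin 7 → ℝ) → (Fin 7 → ℝ) → (Fin 7 → ℝ) :=
    fun u v w => br u (br v w) + br v (br w u) + br w (br u v)
  have Jcyc : ∀ u v w, J u v w = J v w u := by
    intro u v w
    simp only [J]
    abel
  have Jsw : ∀ u v w, J u v w = - J v u w := by
    intro u v w
    simp only [J]
    rw [sk w u, sk v w, sk v u]
    simp only [map_neg]
    abel
  have Jdiag : ∀ u w, J u u w = 0 := by
    intro u w
    simp only [J]
    rw [sk w u, halt u]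
    simp
  have Jdiag2 : ∀ u w, J w u u = 0 := by
    intro u w
    rw [Jcyc]
    exact Jdiag u w
  have Jdiag3 : ∀ u w, J u w u = 0 := by
    intro u w
    rw [Jcyc]
    exact Jdiag2 u w
  let b : Fin 7 → (Fin 7 → ℝ) := ![ξ, X1, Y1, X2, Y2, X3, Y3]
  have Jlt : ∀ i j k : Fin 7, i < j → j < k → J (b i) (b j) (b k) = 0 := by
    clear Jcyc Jsw Jdiag Jdiag2 Jdiag3 hξ hX1 hY1 hX2 hY2 hX3 hY3
    intro i j k hij hjk
    fin_cases i <;> fin_cases j <;> first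
      | exact absurd hij (by decide)
      | (clear hij
         fin_cases k <;> first
          | exact absurd hjk (by decide)
          | (clear hjk sk
             simp [b, J, smul_add, smul_sub, br1, sk1, br2, sk2, br3, sk3, br4, sk4, br5, sk5, br6, sk6, br7, sk7, br8, sk8, br9, sk9, br10, sk10, br11, sk11, br12, sk12, br13, sk13, br14, sk14, br15, sk15, br16, sk16, br17, sk17, br18, sk18, br19, sk19, br20, sk20, br21, sk21, halt]
             try simp only [smul_smul, hr]
             try module))
  have Jall : ∀ i j k : Fin 7, J (b i) (b j) (b k) = 0 := by
    intro i j k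
    rcases lt_trichotomy i j with h1 | rfl | h1
    · rcases lt_trichotomy j k with h2 | rfl | h2
      · exact Jlt i j k h1 h2
      · exact Jdiag2 _ _
      · rcases lt_trichotomy i k with h3 | rfl | h3
        · rw [Jcyc, Jsw, Jcyc, Jcyc, Jlt i k j h3 h2, neg_zero]
        · exact Jdiag3 _ _
        · rw [Jcyc, Jcyc, Jlt k i j h3 h1]
    · exact Jdiag _ _
    · rcases lt_trichotomy j k with h2 | rfl | h2
      · rcases lt_trichotomy i k with h3 | rfl | h3
        · rw [Jsw, Jlt j i k h1 h3, neg_zero]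
        · exact Jdiag3 _ _
        · rw [Jcyc, Jlt j k i h2 h3]
      · exact Jdiag2 _ _
      · rw [Jsw, Jcyc, Jcyc, Jlt k j i h2 h1, neg_zero]
  have hb : ∀ i, b i = Pi.single i 1 := by
    intro i
    fin_cases i <;> simp [b, hξ, hX1, hY1, hX2, hY2, hX3, hY3]
  have hdec : ∀ u : Fin 7 → ℝ, u = ∑ i, u i • b i := by
    intro u
    simp only [hb]
    exact pi_eq_sum_univ' u
  have J1 : ∀ u v w, (∀ i, J (b i) v w = 0) → J u v w = 0 := by
    intro u v w h
    have e : J u v w = ∑ i, u i • J (b i) v w := by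
      simp only [J]
      conv_lhs => rw [hdec u]
      simp only [map_sum, map_smul, LinearMap.sum_apply, LinearMap.smul_apply, smul_add,
        Finset.sum_add_distrib]
    rw [e]
    simp [h]
  intro u v w
  change J u v w = 0
  refine J1 u v w fun i => ?_
  rw [Jcyc]
  refine J1 _ _ _ fun j => ?_
  rw [Jcyc]
  refine J1 _ _ _ fun k => ?_
  exact Jall _ _ _
end
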